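/- The monoid M presented by generators x0, y0, z0, a1, x1, y1, z1, a2, x2, y2, z2, ... and relations x0 + y0 = x0 + z0, y_l = y_{l+1} + a_{l+1}, z_l = z_{l+1} + a_{l+1}, and x_l = x_{l+1} + y_{l+1} = x_{l+1} + z_{l+1} for all l ≥ 0, is conical, stably finite, archimedean, antisymmetric, separative, and unperforated. -/

import Mathlib

/-- A commutative monoid satisfies the Riesz refinement property if every equation
`x1 + x2 = y1 + y2` admits a refinement matrix. -/
def IsRefinementAddMonoid (M : Type*) [AddCommMonoid M] : Prop :=
  ∀ x1 x2 y1 y2 : M, x1 + x2 = y1 + y2 →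
    ∃ z11 z12 z21 z22 : M,
      x1 = z11 + z12 ∧ x2 = z21 + z22 ∧ y1 = z11 + z21 ∧ y2 = z12 + z22

/-- The algebraic (minimal) ordering on a commutative monoid: `x ≤ y` iff `x + z = y`
for some `z`. -/
def AlgLE {M : Type*} [AddCommMonoid M] (x y : M) : Prop := ∃ z, x + z = y

/-- A commutative monoid is conical if `x + y = 0` implies `x = y = 0`. -/
def IsConical (M : Type*) [AddCommMonoid M] : Prop :=
  ∀ x y : M, x + y = 0 → x = 0 ∧ y = 0

/-- Stably finite: `x + y = x` implies `y = 0`. -/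
def IsStablyFinite (M : Type*) [AddCommMonoid M] : Prop :=
  ∀ x y : M, x + y = x → y = 0

/-- Separative: `2x = 2y = x + y` implies `x = y`. -/
def IsSeparative (M : Type*) [AddCommMonoid M] : Prop :=
  ∀ x y : M, x + x = y + y → x + x = x + y → x = y

/-- Cancellative: `x + y = x + z` implies `y = z`. -/
def IsCancellative (M : Type*) [AddCommMonoid M] : Prop :=
  ∀ x y z : M, x + y = x + z → y = z

/-- Unperforated: `m x ≤ m y` implies `x ≤ y` (algebraic order), for positive `m`. -/
def IsUnperforated (M : Type*) [AddCommMonoid M] : Prop :=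
  ∀ (m : ℕ) (x y : M), 0 < m → AlgLE (m • x) (m • y) → AlgLE x y

/-- Antisymmetric: the algebraic ordering is antisymmetric. -/
def IsAntisymmetricMon (M : Type*) [AddCommMonoid M] : Prop :=
  ∀ x y : M, AlgLE x y → AlgLE y x → x = y

/-- Archimedean: if `n x ≤ y` for all positive `n`, then `x` is invertible. -/
def IsArchimedeanMon (M : Type*) [AddCommMonoid M] : Prop :=
  ∀ x y : M, (∀ n : ℕ, 0 < n → AlgLE (n • x) y) → IsAddUnit x

/-- Riesz interpolation property. -/
def HasRieszInterpolation (M : Type*) [AddCommMonoid M] : Prop :=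
  ∀ x1 x2 y1 y2 : M, AlgLE x1 y1 → AlgLE x1 y2 → AlgLE x2 y1 → AlgLE x2 y2 →
    ∃ z : M, AlgLE x1 z ∧ AlgLE x2 z ∧ AlgLE z y1 ∧ AlgLE z y2

/-- An element is irreducible if it is not invertible and whenever `x = a + b`,
either `a` or `b` is invertible. -/
def IsIrreducibleElem {M : Type*} [AddCommMonoid M] (x : M) : Prop :=
  ¬ IsAddUnit x ∧ ∀ a b : M, x = a + b → IsAddUnit a ∨ IsAddUnit b

/-- Generators of the free commutative monoid underlying the monoid `M` of Section 4:
`Sum.inl (0, l)`, `Sum.inl (1, l)`, `Sum.inl (2, l)` are `x_l`, `y_l`, `z_l` (for `l ≥ 0`),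
and `Sum.inr l` is `a_{l+1}` (for `l ≥ 0`). -/
abbrev FreeGenM : Type := (Fin 3 × ℕ) ⊕ ℕ

/-- The free commutative monoid on the generators. -/
abbrev FreeMonM : Type := FreeGenM →₀ ℕ

/-- The generator `x_l`. -/
noncomputable def Xg (l : ℕ) : FreeMonM := Finsupp.single (Sum.inl (0, l)) 1
/-- The generator `y_l`. -/
noncomputable def Yg (l : ℕ) : FreeMonM := Finsupp.single (Sum.inl (1, l)) 1
/-- The generator `z_l`. -/
noncomputable def Zg (l : ℕ) : FreeMonM := Finsupp.single (Sum.inl (2, l)) 1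
/-- The generator `a_{l+1}` (so `Ag 0 = a_1`, `Ag 1 = a_2`, ...). -/
noncomputable def Ag (l : ℕ) : FreeMonM := Finsupp.single (Sum.inr l) 1

/-- The defining relations: `x0 + y0 = x0 + z0`, `y_l = y_{l+1} + a_{l+1}`,
`z_l = z_{l+1} + a_{l+1}`, `x_l = x_{l+1} + y_{l+1}`, `x_l = x_{l+1} + z_{l+1}`. -/
def MRel : FreeMonM → FreeMonM → Prop := fun u v =>
  (u = Xg 0 + Yg 0 ∧ v = Xg 0 + Zg 0) ∨
  (∃ l, u = Yg l ∧ v = Yg (l + 1) + Ag l) ∨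
  (∃ l, u = Zg l ∧ v = Zg (l + 1) + Ag l) ∨
  (∃ l, u = Xg l ∧ v = Xg (l + 1) + Yg (l + 1)) ∨
  (∃ l, u = Xg l ∧ v = Xg (l + 1) + Zg (l + 1))

/-- The smallest congruence containing the defining relations. -/
noncomputable def MCon : AddCon FreeMonM := addConGen MRel

/-- The monoid `M` of Section 4 of the paper. -/
abbrev MonM : Type := MCon.Quotient

/-- The image of `x_l` in `M`. -/
noncomputable def xq (l : ℕ) : MonM := MCon.mk' (Xg l)
/-- The image of `y_l` in `M`. -/
noncomputable def yq (l : ℕ) : MonM := MCon.mk' (Yg l)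
/-- The image of `z_l` in `M`. -/
noncomputable def zq (l : ℕ) : MonM := MCon.mk' (Zg l)
/-- The image of `a_{l+1}` in `M`. -/
noncomputable def aq (l : ℕ) : MonM := MCon.mk' (Ag l)


theorem mq_eq {u v : FreeMonM} (h : MRel u v) : MCon.mk' u = MCon.mk' v :=
  (AddCon.eq MCon).2 (AddConGen.Rel.of _ _ h)

theorem yq_step (l : ℕ) : yq l = yq (l + 1) + aq l := by
  have := mq_eq (u := Yg l) (v := Yg (l + 1) + Ag l) (Or.inr (Or.inl ⟨l, rfl, rfl⟩))
  rwa [map_add] at this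

theorem zq_step (l : ℕ) : zq l = zq (l + 1) + aq l := by
  have := mq_eq (u := Zg l) (v := Zg (l + 1) + Ag l) (Or.inr (Or.inr (Or.inl ⟨l, rfl, rfl⟩)))
  rwa [map_add] at this

theorem xq_step (l : ℕ) : xq l = xq (l + 1) + yq (l + 1) := by
  have := mq_eq (u := Xg l) (v := Xg (l + 1) + Yg (l + 1))
    (Or.inr (Or.inr (Or.inr (Or.inl ⟨l, rfl, rfl⟩))))
  rwa [map_add] at this

theorem xq_step' (l : ℕ) : xq l = xq (l + 1) + zq (l + 1) := by
  have := mq_eq (u := Xg l) (v := Xg (l + 1) + Zg (l + 1))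
    (Or.inr (Or.inr (Or.inr (Or.inr ⟨l, rfl, rfl⟩))))
  rwa [map_add] at this

theorem xz_eq (l : ℕ) : xq l + zq l = xq l + yq l := by
  cases l with
  | zero =>
    have := mq_eq (u := Xg 0 + Yg 0) (v := Xg 0 + Zg 0) (Or.inl ⟨rfl, rfl⟩)
    rw [map_add, map_add] at this
    exact this.symm
  | succ l => rw [← xq_step, ← xq_step']

/-- Homomorphisms out of `M`. -/
noncomputable def homM {N : Type} [AddCommMonoid N] (x y z a : ℕ → N)
    (h0 : x 0 + y 0 = x 0 + z 0) (h1 : ∀ l, y l = y (l + 1) + a l)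
    (h2 : ∀ l, z l = z (l + 1) + a l) (h3 : ∀ l, x l = x (l + 1) + y (l + 1))
    (h4 : ∀ l, x l = x (l + 1) + z (l + 1)) :
    {φ : MonM →+ N // (∀ l, φ (xq l) = x l) ∧ (∀ l, φ (yq l) = y l) ∧
      (∀ l, φ (zq l) = z l) ∧ (∀ l, φ (aq l) = a l)} := by
  let v : FreeGenM → N := Sum.elim (fun p => ![x p.2, y p.2, z p.2] p.1) a
  let F : FreeMonM →+ N := Finsupp.liftAddHom (fun g => multiplesHom N (v g))
  have hX : ∀ l, F (Xg l) = x l := fun l => by simp [F, Xg, v]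
  have hY : ∀ l, F (Yg l) = y l := fun l => by simp [F, Yg, v]
  have hZ : ∀ l, F (Zg l) = z l := fun l => by simp [F, Zg, v]
  have hA : ∀ l, F (Ag l) = a l := fun l => by simp [F, Ag, v]
  have hle : MCon ≤ AddCon.ker F := by
    refine AddCon.addConGen_le.2 ?_
    rintro u w (⟨rfl, rfl⟩ | ⟨l, rfl, rfl⟩ | ⟨l, rfl, rfl⟩ | ⟨l, rfl, rfl⟩ | ⟨l, rfl, rfl⟩) <;>
      rw [AddCon.ker_rel] <;> simp only [map_add, hX, hY, hZ, hA]
    · exact h0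
    · exact h1 l
    · exact h2 l
    · exact h3 l
    · exact h4 l
  exact ⟨AddCon.lift MCon F hle, hX, hY, hZ, hA⟩

/-- the coefficient of `a_{i+1}` at high levels -/
noncomputable def fM (i : ℕ) := homM (N := ℕ) (fun l => i - l) (fun l => if l ≤ i then 1 else 0)
  (fun l => if l ≤ i then 1 else 0) (fun l => if l = i then 1 else 0) rfl
  (fun l => by split_ifs <;> omega) (fun l => by split_ifs <;> omega)
  (fun l => by split_ifs <;> omega) (fun l => by split_ifs <;> omega)

/-- the `y`-count, infinite when some `x` occurs -/
noncomputable def gM := homM (N := ℕ∞) (fun _ => ⊤) (fun _ => 1) (fun _ => 0) (fun _ => 0)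
  (by simp) (by simp) (by simp) (by simp) (by simp)

/-- normal forms at level `l` -/
noncomputable def nf (l n j k : ℕ) (a : ℕ → ℕ) : MonM :=
  n • xq l + j • yq l + k • zq l + ∑ i ∈ Finset.range l, a i • aq i

theorem nf_add (l n j k n' j' k' : ℕ) (a a' : ℕ → ℕ) :
    nf l n j k a + nf l n' j' k' a' = nf l (n + n') (j + j') (k + k') (a + a') := by
  simp only [nf, add_smul, Pi.add_apply, Finset.sum_add_distrib]
  abel

theorem nf_smul (m l n j k : ℕ) (a : ℕ → ℕ) :
    m • nf l n j k a = nf l (m * n) (m * j) (m * k) (fun i => m * a i) := by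
  simp only [nf, nsmul_add, mul_smul, Finset.sum_nsmul]

theorem nf_step (l n j k : ℕ) (a : ℕ → ℕ) :
    nf l n j k a = nf (l + 1) n (n + j) k (fun i => if i = l then j + k else a i) := by
  have h : ∑ i ∈ Finset.range l, (if i = l then j + k else a i) • aq i
      = ∑ i ∈ Finset.range l, a i • aq i := by
    refine Finset.sum_congr rfl fun i hi => ?_
    rw [if_neg (Finset.mem_range.1 hi).ne]
  simp only [nf, Finset.sum_range_succ, h, if_true, xq_step l, yq_step l, zq_step l, add_smul,
    nsmul_add]
  abel

theorem nf_up {l m : ℕ} (h : l ≤ m) {x : MonM} (hx : ∃ n j k a, x = nf l n j k a) :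
    ∃ n j k a, x = nf m n j k a := by
  induction m, h using Nat.le_induction with
  | base => exact hx
  | succ m _ ih =>
    obtain ⟨n, j, k, a, rfl⟩ := ih
    exact ⟨_, _, _, _, nf_step _ _ _ _ _⟩

theorem exists_nf (x : MonM) : ∃ l n j k a, x = nf l n j k a := by
  induction x using AddCon.induction_on with
  | _ u =>
  induction u using Finsupp.induction_linear with
  | zero => exact ⟨0, 0, 0, 0, 0, by simp [nf]⟩
  | add u v hu hv =>
    obtain ⟨l, hu⟩ := hu
    obtain ⟨m, hv⟩ := hv
    obtain ⟨n, j, k, a, hu⟩ := nf_up (le_max_left l m) hu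
    obtain ⟨n', j', k', a', hv⟩ := nf_up (le_max_right l m) hv
    exact ⟨_, _, _, _, _, by rw [AddCon.coe_add, hu, hv]; exact nf_add _ _ _ _ _ _ _ _ _⟩
  | single g c =>
    have key : ∀ (g : FreeGenM), ((Finsupp.single g c : FreeMonM) : MonM)
        = c • MCon.mk' (Finsupp.single g 1) := fun g => by
      rw [← map_nsmul, Finsupp.smul_single, smul_eq_mul, mul_one]; rfl
    rw [key]
    rcases g with ⟨t, l⟩ | i
    · fin_cases t
      · exact ⟨l, c, 0, 0, 0, by simp [nf, xq, Xg]⟩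
      · exact ⟨l, 0, c, 0, 0, by simp [nf, yq, Yg]⟩
      · exact ⟨l, 0, 0, c, 0, by simp [nf, zq, Zg]⟩
    · exact ⟨i + 1, 0, 0, 0, fun t => if t = i then c else 0, by
        simp [nf, aq, Ag, ite_smul]⟩

theorem f_nf (i l n j k : ℕ) (a : ℕ → ℕ) : (fM i).1 (nf l n j k a)
    = n * (i - l) + (if l ≤ i then j + k else 0) + (if i < l then a i else 0) := by
  obtain ⟨hx, hy, hz, ha⟩ := (fM i).2
  simp only [nf, map_add, map_nsmul, map_sum, hx, hy, hz, ha, smul_eq_mul]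
  simp only [mul_ite, mul_one, mul_zero, Finset.sum_ite_eq', Finset.mem_range]
  split_ifs <;> omega

theorem g_nf (l j k : ℕ) (a : ℕ → ℕ) : gM.1 (nf l 0 j k a) = j := by
  obtain ⟨hx, hy, hz, ha⟩ := gM.2
  simp [nf, hy, hz, ha]

theorem nf_xpos (l n j k : ℕ) (a : ℕ → ℕ) :
    nf l (n + 1) j k a = nf l (n + 1) (j + k) 0 a := by
  induction k generalizing j with
  | zero => rfl
  | succ k ih =>
    have : nf l (n + 1) j (k + 1) a = nf l (n + 1) (j + 1) k a := by
      have h := xz_eq l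
      calc _ = (xq l + zq l) + (n • xq l + j • yq l + k • zq l
            + ∑ i ∈ Finset.range l, a i • aq i) := by
              simp only [nf, add_smul, one_smul]; abel
        _ = _ := by rw [h]; simp only [nf, add_smul, one_smul]; abel
    rw [this, ih]; congr 1; omega

theorem nf_congr {l n j k n' j' k' : ℕ} {a a' : ℕ → ℕ} (hn : n = n') (hs : j + k = j' + k')
    (ha : ∀ i < l, a i = a' i) (hj : n = 0 → j = j') : nf l n j k a = nf l n' j' k' a' := by
  subst hn
  have h : ∀ j k, nf l n j k a = nf l n j k a' := fun j k => by
    unfold nf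
    congr 1
    exact Finset.sum_congr rfl fun i hi => by rw [ha i (Finset.mem_range.1 hi)]
  rw [h]
  cases n with
  | zero =>
    have := hj rfl
    subst this
    have : k = k' := by omega
    rw [this]
  | succ n => rw [nf_xpos, hs, ← nf_xpos]

theorem f_data {l n j k n' j' k' : ℕ} {a a' : ℕ → ℕ}
    (h : ∀ i, (fM i).1 (nf l n j k a) = (fM i).1 (nf l n' j' k' a')) :
    n = n' ∧ j + k = j' + k' ∧ ∀ i < l, a i = a' i := by
  simp only [f_nf] at h
  have h1 := h l
  have h2 := h (l + 1)
  simp at h1 h2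
  refine ⟨by omega, by omega, fun i hi => ?_⟩
  have h3 := h i
  simpa [hi, Nat.not_le.2 hi, Nat.sub_eq_zero_of_le hi.le] using h3

theorem common2 (x y : MonM) : ∃ l, (∃ n j k a, x = nf l n j k a) ∧ ∃ n j k a, y = nf l n j k a := by
  obtain ⟨l, hu⟩ := exists_nf x
  obtain ⟨m, hv⟩ := exists_nf y
  exact ⟨max l m, nf_up (le_max_left l m) hu, nf_up (le_max_right l m) hv⟩

theorem M_ext {x y : MonM} (hf : ∀ i, (fM i).1 x = (fM i).1 y) (hg : gM.1 x = gM.1 y) : x = y := by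
  obtain ⟨l, ⟨n, j, k, a, rfl⟩, n', j', k', a', rfl⟩ := common2 x y
  obtain ⟨hn, hs, ha⟩ := f_data hf
  refine nf_congr hn hs ha fun h0 => ?_
  subst hn
  subst h0
  rw [g_nf, g_nf] at hg
  exact_mod_cast hg

theorem M_zero {x : MonM} (hf : ∀ i, (fM i).1 x = 0) : x = 0 := by
  obtain ⟨l, n, j, k, a, rfl⟩ := exists_nf x
  have h0 : (0 : MonM) = nf l 0 0 0 0 := by simp [nf]
  rw [h0]
  obtain ⟨hn, hs, ha⟩ := f_data (n' := 0) (j' := 0) (k' := 0) (a' := 0) (l := l) (n := n)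
    (j := j) (k := k) (a := a) (fun i => by rw [hf, ← h0, map_zero])
  exact nf_congr hn hs ha fun _ => by omega

theorem M_conical : IsConical MonM := by
  intro x y h
  have : ∀ i, (fM i).1 x + (fM i).1 y = 0 := fun i => by rw [← map_add, h, map_zero]
  exact ⟨M_zero fun i => by have := this i; omega, M_zero fun i => by have := this i; omega⟩

theorem M_sf : IsStablyFinite MonM := by
  intro x y h
  refine M_zero fun i => ?_
  have : (fM i).1 x + (fM i).1 y = (fM i).1 x := by rw [← map_add, h]
  omega

theorem M_arch : IsArchimedeanMon MonM := by
  intro x y h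
  have : x = 0 := by
    refine M_zero fun i => ?_
    obtain ⟨z, hz⟩ := h ((fM i).1 y + 1) (Nat.succ_pos _)
    have := congrArg (fM i).1 hz
    rw [map_add, map_nsmul, smul_eq_mul] at this
    by_contra h0
    have h1 : 1 ≤ (fM i).1 x := Nat.one_le_iff_ne_zero.2 h0
    nlinarith
  rw [this]
  exact isAddUnit_zero

theorem M_anti : IsAntisymmetricMon MonM := by
  rintro x y ⟨u, rfl⟩ ⟨v, hv⟩
  rw [add_assoc] at hv
  have := (M_conical _ _ (M_sf _ _ hv)).1
  rw [this, add_zero]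

theorem M_sep : IsSeparative MonM := by
  intro x y h _
  refine M_ext (fun i => ?_) ?_
  · have := congrArg (fM i).1 h
    rw [map_add, map_add] at this
    omega
  · have := congrArg gM.1 h
    rw [map_add, map_add] at this
    generalize gM.1 x = p at *
    generalize gM.1 y = q at *
    cases p <;> cases q
    · rfl
    · norm_cast at this
    · norm_cast at this
    · norm_cast at this ⊢
      omega

theorem M_unperf : IsUnperforated MonM := by
  rintro m x y hm ⟨z, hz⟩
  obtain ⟨l, hx, hy⟩ := common2 x y
  obtain ⟨l', hz'⟩ := exists_nf z
  obtain ⟨n, j, k, a, rfl⟩ := nf_up (le_max_left l l') hx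
  obtain ⟨n', j', k', a', rfl⟩ := nf_up (le_max_left l l') hy
  obtain ⟨n'', j'', k'', a'', rfl⟩ := nf_up (le_max_right l l') hz'
  generalize max l l' = L at *
  rw [nf_smul, nf_smul, nf_add] at hz
  obtain ⟨hn, hs, ha⟩ := f_data fun i => congrArg (fM i).1 hz
  have le_of : ∀ {p q r : ℕ}, m * p + r = m * q → p ≤ q := fun {p q r} h =>
    Nat.le_of_mul_le_mul_left (by omega) hm
  have hn' := le_of hn
  have ha' : ∀ i < L, a i ≤ a' i := fun i hi => le_of (ha i hi)
  have hs' : j + k ≤ j' + k' := le_of (r := j'' + k'') (by rw [mul_add, mul_add]; omega)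
  rcases Nat.eq_zero_or_pos n' with h0 | h0
  · subst h0
    have e1 : n = 0 := by omega
    subst e1
    have e2 : n'' = 0 := by omega
    subst e2
    have hg := congrArg gM.1 hz
    simp only [mul_zero, add_zero] at hg
    rw [g_nf, g_nf] at hg
    have hg' : m * j + j'' = m * j' := by exact_mod_cast hg
    have hj := le_of hg'
    have hk : k ≤ k' := le_of (r := k'') (by omega)
    refine ⟨nf L 0 (j' - j) (k' - k) (a' - a), ?_⟩
    rw [nf_add]
    exact nf_congr rfl (by omega) (fun i hi => by have := ha' i hi; simp; omega) fun _ => by omega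
  · refine ⟨nf L (n' - n) (j' + k' - (j + k)) 0 (a' - a), ?_⟩
    rw [nf_add]
    exact nf_congr (by omega) (by omega) (fun i hi => by have := ha' i hi; simp; omega)
      fun _ => by omega

/-- The monoid `M` is conical, stably finite, archimedean, antisymmetric, separative,
and unperforated. -/
theorem MonM_properties :
    IsConical MonM ∧ IsStablyFinite MonM ∧ IsArchimedeanMon MonM ∧
    IsAntisymmetricMon MonM ∧ IsSeparative MonM ∧ IsUnperforated MonM :=
  ⟨M_conical, M_sf, M_arch, M_anti, M_sep, M_unperf⟩
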